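/- For every two-sided ideal I of A, √I ⊆ I(V(I)); that is, every element of A lying in all prime two-sided ideals of A containing I belongs to ⟨Z⟩ for every Z ∈ F^n with I ⊆ ⟨Z⟩. -/

import Mathlib

/-- The standard monomial `x^a = x 1 ^ a 1 ⋯ x n ^ a n`. -/
def smon {A : Type*} [Ring A] {n : ℕ} (x : Fin n → A) (a : Fin n → ℕ) : A :=
  (List.ofFn fun i => x i ^ a i).prod

/-- The two-sided ideal `⟨Z⟩` of `A` generated by `x 1 - ι (z 1), …, x n - ι (z n)`. -/
def pointIdeal {F A : Type*} [Field F] [Ring A] {n : ℕ} (ι : F →+* A) (x : Fin n → A)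
    (Z : Fin n → F) : TwoSidedIdeal A :=
  TwoSidedIdeal.span {a | ∃ i, a = x i - ι (Z i)}

/-- `A` is a quasi-commutative bijective skew PBW extension of the field `F`,
via the injective ring homomorphism `ι : F → A` and the variables `x 1, …, x n`. -/
structure IsQuasiCommSkewPBW {F A : Type*} [Field F] [Ring A] {n : ℕ}
    (ι : F →+* A) (x : Fin n → A) : Prop where
  inj : Function.Injective ι
  -- (1) the standard monomials form a basis of A as a left F-vector space
  basis : ∀ a : A, ∃! c : (Fin n → ℕ) →₀ F, a = c.sum fun α r => ι r * smon x α
  -- (2) field automorphisms σ_i of F with x_i ι(r) = ι(σ_i(r)) x_i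
  sigma : ∃ σ : Fin n → F ≃+* F, ∀ (i : Fin n) (r : F), x i * ι r = ι (σ i r) * x i
  -- (3) nonzero q_{ij} ∈ F with x_j x_i = ι(q_{ij}) x_i x_j for i < j
  q : ∃ q : Fin n → Fin n → F, ∀ i j : Fin n, i < j →
        q i j ≠ 0 ∧ x j * x i = ι (q i j) * (x i * x j)

/-- A two-sided ideal `P ⊊ A` is prime if `aAb ⊆ P` implies `a ∈ P` or `b ∈ P`. -/
def IsPrimeTwoSided {A : Type*} [Ring A] (P : TwoSidedIdeal A) : Prop :=
  P ≠ ⊤ ∧ ∀ a b : A, (∀ s : A, a * s * b ∈ P) → a ∈ P ∨ b ∈ P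

/-- Modulo `⟨Z⟩` every element of `A` is congruent to a scalar. -/
lemma exists_sub_mem_pointIdeal {F A : Type*} [Field F] [Ring A] {n : ℕ}
    {ι : F →+* A} {x : Fin n → A} (hA : IsQuasiCommSkewPBW ι x) (Z : Fin n → F) (a : A) :
    ∃ r : F, a - ι r ∈ pointIdeal ι x Z := by
  let π := (pointIdeal ι x Z).ringCon.mk'
  have hπ : ∀ u v : A, π u = π v ↔ u - v ∈ pointIdeal ι x Z := fun u v =>
    (RingCon.eq _).trans (TwoSidedIdeal.rel_iff _ u v)
  let S : Subring A := (π.comp ι).range.comap π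
  have hι : ∀ r, ι r ∈ S := fun r => ⟨r, rfl⟩
  have hx : ∀ i, x i ∈ S := fun i =>
    ⟨Z i, ((hπ _ _).2 (TwoSidedIdeal.subset_span ⟨i, rfl⟩)).symm⟩
  have ha : a ∈ S := by
    obtain ⟨c, hc, -⟩ := hA.basis a
    rw [hc]
    refine S.sum_mem fun α _ => S.mul_mem (hι _) (S.list_prod_mem fun y hy => ?_)
    obtain ⟨i, rfl⟩ := (List.mem_ofFn' _ _).1 hy
    exact S.pow_mem (hx i) _
  obtain ⟨r, hr⟩ := ha
  exact ⟨r, (hπ _ _).1 hr.symm⟩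

/-- A proper two-sided ideal modulo which every element is congruent to a scalar is prime. -/
lemma isPrimeTwoSided_of_exists_sub_mem {F A : Type*} [Field F] [Ring A] (ι : F →+* A)
    {P : TwoSidedIdeal A} (hP : P ≠ ⊤) (h : ∀ a : A, ∃ r : F, a - ι r ∈ P) :
    IsPrimeTwoSided P := by
  refine ⟨hP, fun a b hab => ?_⟩
  obtain ⟨r, hr⟩ := h a
  by_cases hr0 : r = 0
  · left
    simpa [hr0] using hr
  · right
    have hab' : a * b ∈ P := by simpa using hab 1
    have hrb : ι r * b ∈ P := by
      have := P.sub_mem hab' (P.mul_mem_right _ b hr)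
      simpa [sub_mul] using this
    have := P.mul_mem_left (ι r⁻¹) _ hrb
    rwa [← mul_assoc, ← map_mul, inv_mul_cancel₀ hr0, map_one, one_mul] at this

theorem stmt16 {F A : Type*} [Field F] [Ring A] {n : ℕ}
    (ι : F →+* A) (x : Fin n → A) (hA : IsQuasiCommSkewPBW ι x)
    (I : TwoSidedIdeal A) (f : A)
    -- f ∈ √I : f lies in every prime two-sided ideal of A containing I
    (hf : ∀ P : TwoSidedIdeal A, IsPrimeTwoSided P → I ≤ P → f ∈ P) :
    -- f ∈ I(V(I)) : f ∈ ⟨Z⟩ for every Z ∈ F^n with I ⊆ ⟨Z⟩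
    ∀ Z : Fin n → F, I ≤ pointIdeal ι x Z → f ∈ pointIdeal ι x Z := by
  intro Z hZ
  by_cases hP : pointIdeal ι x Z = ⊤
  · rw [hP]
    trivial
  · exact hf _ (isPrimeTwoSided_of_exists_sub_mem ι hP (exists_sub_mem_pointIdeal hA Z)) hZ
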